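/- arXiv:2504.08147 — 4 statements merged into one kernel-verified Lean document; each statement's English description precedes it below -/
import Mathlib

section
/- Let n ≥ 3, fix 1 < s < ∞, 0 < r < s−1, and α > r−1, and let σ be a nonnegative Borel measure on ℝⁿ, finite on bounded sets, with ∫_{ℝⁿ} (W_sσ)^((s−1)(1+α)/(s−1−r)) dσ < ∞. Then there exists a constant c₀ > 0 such that for every Borel function u : ℝⁿ → [0,∞], ∫_{ℝⁿ} ( W_s(u^r·dσ) )^(1+α) dσ ≤ c₀ · ( ∫_{ℝⁿ} u^(1+α) dσ )^(r/(s−1)). -/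
open MeasureTheory Metric Set
open scoped ENNReal

noncomputable def gfun (p q : ℝ) (t : ℝ≥0∞) : ℝ≥0∞ := t ^ (p - 1) + t ^ (q - 1)

noncomputable def ffun (p q γ : ℝ) (t : ℝ≥0∞) : ℝ≥0∞ :=
  t ^ ((p - 1) * γ) + t ^ ((q - 1) * γ)

noncomputable def Ffun (p q γ : ℝ) (t : ℝ≥0∞) : ℝ≥0∞ :=
  t ^ ((p - 1) * γ + 1) / ENNReal.ofReal ((p - 1) * γ + 1)
    + t ^ ((q - 1) * γ + 1) / ENNReal.ofReal ((q - 1) * γ + 1)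

/-- The Wolff-type potential `W_G σ(x) = ∫₀^∞ h(σ(B(x,t))/t^(n−1)) dt`,
where `h` is the inverse of `g`. -/
noncomputable def wolffG (n : ℕ) (h : ℝ≥0∞ → ℝ≥0∞)
    (σ : Measure (EuclideanSpace ℝ (Fin n))) (x : EuclideanSpace ℝ (Fin n)) : ℝ≥0∞ :=
  ∫⁻ t in Set.Ioi (0 : ℝ), h (σ (ball x t) / ENNReal.ofReal t ^ (n - 1))

/-- The classical Wolff potential `W_s σ(x) = ∫₀^∞ (σ(B(x,t))/t^(n−1))^(1/(s−1)) dt`. -/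
noncomputable def wolffS (n : ℕ) (s : ℝ)
    (σ : Measure (EuclideanSpace ℝ (Fin n))) (x : EuclideanSpace ℝ (Fin n)) : ℝ≥0∞ :=
  ∫⁻ t in Set.Ioi (0 : ℝ), (σ (ball x t) / ENNReal.ofReal t ^ (n - 1)) ^ (1 / (s - 1))

/-- Condition (A) on the measure σ. -/
def condA (n : ℕ) (p q γ : ℝ) (σ : Measure (EuclideanSpace ℝ (Fin n))) : Prop :=
  ∀ s ∈ ({p, q} : Set ℝ),
    ∀ θ ∈ ({1 / (1 - γ), (p - 1) / (p - 1 - γ * (q - 1)),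
            (q - 1) / (q - 1 - γ * (p - 1))} : Set ℝ),
      (∫⁻ x, Ffun p q γ ((wolffS n s σ x) ^ θ) ∂σ) < ⊤

section HardyLittlewood

variable {X : Type*} [MetricSpace X] [SecondCountableTopology X] [MeasurableSpace X]
  [OpensMeasurableSpace X]

/-- The centered maximal function of `ν` relative to `σ`, over balls of positive rational radius. -/
noncomputable def centeredMaximal (σ ν : Measure X) (x : X) : ℝ≥0∞ :=
  ⨆ q : {q : ℚ // 0 < q}, ν (ball x (q : ℚ)) / σ (ball x (q : ℚ))

/-- Besicovitch covering estimate: there is a constant `N` such that if every point of `E` is the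
center of a ball of radius at most `R` whose `ν`-measure is at least `c` times its `σ`-measure,
then `c * σ E ≤ N * ν univ`. -/
lemma exists_mul_measure_le_of_bounded_balls (X : Type*) [MetricSpace X]
    [SecondCountableTopology X] [MeasurableSpace X] [OpensMeasurableSpace X]
    [HasBesicovitchCovering X] :
    ∃ N : ℕ, ∀ (σ ν : Measure X) (c : ℝ≥0∞) (R : ℝ) (E : Set X),
      (∀ x ∈ E, ∃ t, 0 < t ∧ t ≤ R ∧ c * σ (ball x t) ≤ ν (ball x t)) →
        c * σ E ≤ N * ν univ := by
  obtain ⟨N, τ, hτ, hN⟩ := HasBesicovitchCovering.no_satelliteConfig (α := X)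
  refine ⟨N, fun σ ν c R E hE => ?_⟩
  choose! t ht0 htR ht using hE
  let q : Besicovitch.BallPackage E X :=
    { c := fun x => x
      r := fun x => t x
      rpos := fun x => ht0 x x.2
      r_bound := R
      r_le := fun x => htR x x.2 }
  obtain ⟨S, hS, hcov⟩ := Besicovitch.exist_disjoint_covering_families hτ hN q
  have hdisj (i : Fin N) : (S i).PairwiseDisjoint fun j => ball (q.c j) (q.r j) :=
    (hS i).mono fun _ => ball_subset_closedBall
  have hcount (i : Fin N) : (S i).Countable :=
    (hdisj i).countable_of_isOpen (fun _ _ => isOpen_ball)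
      fun j _ => nonempty_ball.2 (q.rpos j)
  have hfamily (i : Fin N) : c * σ (⋃ j ∈ S i, ball (q.c j) (q.r j)) ≤ ν univ := by
    rw [measure_biUnion (hcount i) (hdisj i) fun _ _ => measurableSet_ball,
      ← ENNReal.tsum_mul_left]
    calc ∑' j : S i, c * σ (ball (q.c j) (q.r j))
        ≤ ∑' j : S i, ν (ball (q.c j) (q.r j)) :=
          ENNReal.tsum_le_tsum fun j => ht _ j.1.2
      _ = ν (⋃ j ∈ S i, ball (q.c j) (q.r j)) :=
          (measure_biUnion (hcount i) (hdisj i) fun _ _ => measurableSet_ball).symm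
      _ ≤ ν univ := measure_mono (subset_univ _)
  have hEcov : E ⊆ ⋃ i : Fin N, ⋃ j ∈ S i, ball (q.c j) (q.r j) :=
    fun x hx => hcov ⟨⟨x, hx⟩, rfl⟩
  calc c * σ E ≤ c * ∑ i : Fin N, σ (⋃ j ∈ S i, ball (q.c j) (q.r j)) := by
        gcongr
        exact (measure_mono hEcov).trans (measure_iUnion_fintype_le _ _)
    _ = ∑ i : Fin N, c * σ (⋃ j ∈ S i, ball (q.c j) (q.r j)) := Finset.mul_sum _ _ _
    _ ≤ ∑ _i : Fin N, ν univ := Finset.sum_le_sum fun i _ => hfamily i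
    _ = N * ν univ := by simp

/-- Weak type `(1, 1)` estimate for the centered maximal function, stated on superlevel sets. -/
lemma exists_mul_measure_le_of_balls (X : Type*) [MetricSpace X]
    [SecondCountableTopology X] [MeasurableSpace X] [OpensMeasurableSpace X]
    [HasBesicovitchCovering X] :
    ∃ N : ℕ, ∀ (σ ν : Measure X) (c : ℝ≥0∞) (E : Set X),
      (∀ x ∈ E, ∃ t, 0 < t ∧ c * σ (ball x t) ≤ ν (ball x t)) → c * σ E ≤ N * ν univ := by
  obtain ⟨N, hN⟩ := exists_mul_measure_le_of_bounded_balls X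
  refine ⟨N, fun σ ν c E hE => ?_⟩
  choose! t ht0 ht using hE
  have hmono : Monotone fun m : ℕ => {x ∈ E | t x ≤ m} :=
    fun a b hab x hx => ⟨hx.1, hx.2.trans (by exact_mod_cast hab)⟩
  have hunion : E = ⋃ m : ℕ, {x ∈ E | t x ≤ m} := by
    ext x
    simp only [mem_iUnion, mem_ofPred_eq, exists_and_left, iff_self_and]
    exact fun _ => exists_nat_ge (t x)
  rw [hunion, hmono.measure_iUnion, ENNReal.mul_iSup]
  exact iSup_le fun m => hN σ ν c m _ fun x hx => ⟨t x, ht0 x hx.1, hx.2, ht x hx.1⟩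

lemma measurable_measure_ball (μ : Measure X) [SFinite μ] :
    Measurable fun p : X × ℝ => μ (ball p.1 p.2) := by
  have hS : MeasurableSet {z : (X × ℝ) × X | dist z.2 z.1.1 < z.1.2} :=
    measurableSet_lt (measurable_snd.dist (measurable_fst.comp measurable_fst))
      (measurable_snd.comp measurable_fst)
  exact measurable_measure_prodMk_left hS

lemma measurable_centeredMaximal (σ ν : Measure X) [SFinite σ] [SFinite ν] :
    Measurable (centeredMaximal σ ν) := by
  have h (μ : Measure X) [SFinite μ] (r : ℝ) : Measurable fun x => μ (ball x r) :=
    (measurable_measure_ball μ).comp (measurable_id.prodMk measurable_const)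
  exact Measurable.iSup fun q => (h ν _).div (h σ _)

omit [SecondCountableTopology X] [OpensMeasurableSpace X] in
lemma measure_ball_le_centeredMaximal_mul {σ ν : Measure X} (hac : ν ≪ σ)
    (hfin : ∀ (x : X) (ρ : ℝ), σ (ball x ρ) < ⊤) (x : X) (t : ℝ) :
    ν (ball x t) ≤ centeredMaximal σ ν x * σ (ball x t) := by
  have hball : ball x t ⊆ ⋃ q : {q : {q : ℚ // 0 < q} // ((q : ℚ) : ℝ) ≤ t}, ball x (q.1 : ℚ) := by
    intro y hy
    obtain ⟨q, hq, hqt⟩ := exists_rat_btwn (mem_ball.1 hy)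
    have hq0 : 0 < q := by exact_mod_cast dist_nonneg.trans_lt hq
    exact mem_iUnion.2 ⟨⟨⟨q, hq0⟩, hqt.le⟩, hq⟩
  have hdir : Directed (· ⊆ ·)
      fun q : {q : {q : ℚ // 0 < q} // ((q : ℚ) : ℝ) ≤ t} => ball x (q.1 : ℚ) :=
    Monotone.directed_le fun a b hab => ball_subset_ball (by exact_mod_cast hab)
  refine (measure_mono hball).trans ?_
  rw [hdir.measure_iUnion]
  refine iSup_le fun q => ?_
  have hq : ν (ball x (q.1 : ℚ)) ≤
      ν (ball x (q.1 : ℚ)) / σ (ball x (q.1 : ℚ)) * σ (ball x (q.1 : ℚ)) := by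
    by_cases h0 : σ (ball x (q.1 : ℚ)) = 0
    · simp [hac h0]
    · rw [ENNReal.div_mul_cancel h0 (hfin _ _).ne]
  refine hq.trans ?_
  gcongr
  · exact le_iSup (fun q : {q : ℚ // 0 < q} => ν (ball x (q : ℚ)) / σ (ball x (q : ℚ))) q.1
  · exact q.2

omit [SecondCountableTopology X] [OpensMeasurableSpace X] in
lemma exists_pos_mul_lt_of_lt_centeredMaximal {σ ν : Measure X} {x : X} {c : ℝ≥0∞}
    (h : c < centeredMaximal σ ν x) :
    ∃ t : ℝ, 0 < t ∧ c * σ (ball x t) ≤ ν (ball x t) := by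
  obtain ⟨q, hq⟩ := lt_iSup_iff.1 h
  exact ⟨(q : ℚ), by exact_mod_cast q.2, ENNReal.mul_le_of_le_div hq.le⟩

/-- Weak type estimate in terms of the part of `f` lying above half the level. -/
lemma exists_mul_measure_centeredMaximal_le (X : Type*) [MetricSpace X]
    [SecondCountableTopology X] [MeasurableSpace X] [OpensMeasurableSpace X]
    [HasBesicovitchCovering X] :
    ∃ N : ℕ, ∀ (σ : Measure X), (∀ (x : X) (ρ : ℝ), σ (ball x ρ) < ⊤) →
      ∀ f : X → ℝ≥0∞, Measurable f → ∀ c : ℝ≥0∞, c ≠ ⊤ →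
        c * σ {x | 2 * c < centeredMaximal σ (σ.withDensity f) x} ≤
          N * ∫⁻ x in {x | c < f x}, f x ∂σ := by
  obtain ⟨N, hN⟩ := exists_mul_measure_le_of_balls X
  refine ⟨N, fun σ hfin f hf c hc => ?_⟩
  have hmeas : MeasurableSet {x | c < f x} := measurableSet_lt measurable_const hf
  have key := hN σ (σ.withDensity ({x | c < f x}.indicator f)) c
    {x | 2 * c < centeredMaximal σ (σ.withDensity f) x} ?_
  · rwa [withDensity_apply _ MeasurableSet.univ, Measure.restrict_univ,
      lintegral_indicator hmeas] at key
  intro x hx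
  obtain ⟨t, ht, hle⟩ := exists_pos_mul_lt_of_lt_centeredMaximal hx
  refine ⟨t, ht, ?_⟩
  rw [withDensity_apply _ measurableSet_ball] at hle ⊢
  have hsplit : ∫⁻ y in ball x t, f y ∂σ ≤
      (∫⁻ y in ball x t, {x | c < f x}.indicator f y ∂σ) + c * σ (ball x t) := by
    rw [← setLIntegral_const, ← lintegral_add_right _ measurable_const]
    refine lintegral_mono fun y => ?_
    by_cases hy : c < f y
    · simp [hy]
    · simpa [hy] using not_lt.1 hy
  have hfinite : c * σ (ball x t) ≠ ⊤ := ENNReal.mul_ne_top hc (hfin x t).ne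
  rw [mul_assoc, two_mul] at hle
  exact (ENNReal.add_le_add_iff_right hfinite).1 (hle.trans hsplit)

lemma setLIntegral_rpow_sub_one_of_ne_top {y : ℝ≥0∞} (hy : y ≠ ⊤) {p : ℝ} (hp : 0 < p) :
    ENNReal.ofReal p * ∫⁻ t in Ioi (0 : ℝ),
      {t : ℝ | ENNReal.ofReal t < y}.indicator (fun t => ENNReal.ofReal (t ^ (p - 1))) t =
        y ^ p := by
  have h := lintegral_rpow_eq_lintegral_meas_lt_mul (Measure.dirac ()) (f := fun _ => y.toReal)
    (Filter.Eventually.of_forall fun _ => ENNReal.toReal_nonneg) aemeasurable_const hp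
  rw [lintegral_const, measure_univ, mul_one,
    ← ENNReal.ofReal_rpow_of_nonneg ENNReal.toReal_nonneg hp.le, ENNReal.ofReal_toReal hy] at h
  rw [h]
  congr 1
  refine setLIntegral_congr_fun measurableSet_Ioi fun t ht => ?_
  by_cases hlt : ENNReal.ofReal t < y
  · have : t < y.toReal := (ENNReal.ofReal_lt_iff_lt_toReal (le_of_lt ht) hy).1 hlt
    simp [hlt, this]
  · have : ¬ t < y.toReal := fun h' => hlt ((ENNReal.ofReal_lt_iff_lt_toReal (le_of_lt ht) hy).2 h')
    simp [hlt, this]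

/-- Layer cake formula for a single extended nonnegative real. -/
lemma ofReal_mul_setLIntegral_indicator_rpow (y : ℝ≥0∞) {p : ℝ} (hp : 0 < p) :
    ENNReal.ofReal p * ∫⁻ t in Ioi (0 : ℝ),
      {t : ℝ | ENNReal.ofReal t < y}.indicator (fun t => ENNReal.ofReal (t ^ (p - 1))) t =
        y ^ p := by
  by_cases hy : y = ⊤
  · subst hy
    rw [ENNReal.top_rpow_of_pos hp]
    refine ENNReal.eq_top_of_forall_nnreal_le fun r => ?_
    have hr : (r : ℝ≥0∞) = ((r : ℝ≥0∞) ^ (1 / p)) ^ p := by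
      rw [← ENNReal.rpow_mul, one_div_mul_cancel hp.ne', ENNReal.rpow_one]
    rw [hr, ← setLIntegral_rpow_sub_one_of_ne_top
      (ENNReal.rpow_ne_top_of_nonneg (by positivity) ENNReal.coe_ne_top) hp]
    gcongr
    exact le_top
  · exact setLIntegral_rpow_sub_one_of_ne_top hy hp

/-- Weighted layer cake formula for functions with values in the extended nonnegative reals. -/
lemma ofReal_mul_lintegral_setLIntegral_lt_mul_rpow {Y : Type*} [MeasurableSpace Y]
    (σ : Measure Y) [SFinite σ] {g h : Y → ℝ≥0∞} (hg : Measurable g) (hh : Measurable h)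
    {p : ℝ} (hp : 0 < p) :
    ENNReal.ofReal p * ∫⁻ t in Ioi (0 : ℝ),
      (∫⁻ x in {x | ENNReal.ofReal t < g x}, h x ∂σ) * ENNReal.ofReal (t ^ (p - 1)) =
        ∫⁻ x, h x * g x ^ p ∂σ := by
  have hset : MeasurableSet {z : ℝ × Y | ENNReal.ofReal z.1 < g z.2} :=
    measurableSet_lt (by fun_prop) (by fun_prop)
  have hmeas : Measurable fun z : ℝ × Y => {z : ℝ × Y | ENNReal.ofReal z.1 < g z.2}.indicator
      (fun z => h z.2 * ENNReal.ofReal (z.1 ^ (p - 1))) z :=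
    Measurable.indicator (by fun_prop) hset
  have hinner (t : ℝ) : (∫⁻ x in {x | ENNReal.ofReal t < g x}, h x ∂σ) *
      ENNReal.ofReal (t ^ (p - 1)) = ∫⁻ x, {z : ℝ × Y | ENNReal.ofReal z.1 < g z.2}.indicator
        (fun z => h z.2 * ENNReal.ofReal (z.1 ^ (p - 1))) (t, x) ∂σ := by
    rw [← lintegral_mul_const _ hh,
      ← lintegral_indicator (measurableSet_lt measurable_const hg)]
    exact lintegral_congr fun x => by simp only [indicator, mem_ofPred_eq]
  simp_rw [hinner]
  rw [lintegral_lintegral_swap hmeas.aemeasurable, ← lintegral_const_mul' _ _ ENNReal.ofReal_ne_top]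
  refine lintegral_congr fun x => ?_
  have hpoint (t : ℝ) : {z : ℝ × Y | ENNReal.ofReal z.1 < g z.2}.indicator
      (fun z => h z.2 * ENNReal.ofReal (z.1 ^ (p - 1))) (t, x) =
        h x * {t : ℝ | ENNReal.ofReal t < g x}.indicator
          (fun t => ENNReal.ofReal (t ^ (p - 1))) t := by
    simp only [indicator, mem_ofPred_eq, mul_ite, mul_zero]
  simp_rw [hpoint]
  rw [lintegral_const_mul, mul_left_comm, ofReal_mul_setLIntegral_indicator_rpow _ hp]
  exact Measurable.indicator (by fun_prop)
    (measurableSet_lt ENNReal.measurable_ofReal measurable_const)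

/-- Strong type `(p, p)` estimate for the centered maximal function. -/
lemma exists_lintegral_centeredMaximal_rpow_le [HasBesicovitchCovering X] (σ : Measure X)
    [SFinite σ] (hfin : ∀ (x : X) (ρ : ℝ), σ (ball x ρ) < ⊤) {p : ℝ} (hp : 1 < p) :
    ∃ C : ℝ≥0∞, C ≠ ⊤ ∧ ∀ f : X → ℝ≥0∞, Measurable f →
      ∫⁻ x, centeredMaximal σ (σ.withDensity f) x ^ p ∂σ ≤ C * ∫⁻ x, f x ^ p ∂σ := by
  obtain ⟨N, hN⟩ := exists_mul_measure_centeredMaximal_le X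
  have hp0 : 0 < p := by linarith
  have hp1 : 0 < p - 1 := by linarith
  have hp1' : ENNReal.ofReal (p - 1) ≠ 0 := by simpa using hp1
  refine ⟨ENNReal.ofReal p * (2 * N * ((ENNReal.ofReal (p - 1))⁻¹ * 2 ^ (p - 1))), ?_,
    fun f hf => ?_⟩
  · finiteness
  set M := centeredMaximal σ (σ.withDensity f)
  have hM : Measurable M := measurable_centeredMaximal _ _
  have hweak (t : ℝ) (ht : 0 < t) :
      (∫⁻ _x in {x | ENNReal.ofReal t < M x}, 1 ∂σ) * ENNReal.ofReal (t ^ (p - 1)) ≤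
        2 * N * ((∫⁻ x in {x | ENNReal.ofReal t < 2 * f x}, f x ∂σ) *
          ENNReal.ofReal (t ^ (p - 1 - 1))) := by
    have htwo : 2 * ENNReal.ofReal (t / 2) = ENNReal.ofReal t := by
      rw [← ENNReal.ofReal_ofNat, ← ENNReal.ofReal_mul zero_le_two, mul_div_cancel₀ _ two_ne_zero]
    have hlevel : {x | ENNReal.ofReal t < 2 * f x} = {x | ENNReal.ofReal (t / 2) < f x} := by
      ext x
      simp only [mem_ofPred_eq, ← htwo]
      exact ENNReal.mul_lt_mul_iff_right two_ne_zero ENNReal.ofNat_ne_top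
    have hpow : ENNReal.ofReal (t ^ (p - 1)) =
        2 * ENNReal.ofReal (t / 2) * ENNReal.ofReal (t ^ (p - 1 - 1)) := by
      rw [htwo, ← ENNReal.ofReal_mul ht.le, Real.rpow_sub_one ht.ne' (p - 1), mul_div_cancel₀ _ ht.ne']
    have h := hN σ hfin f hf (ENNReal.ofReal (t / 2)) ENNReal.ofReal_ne_top
    rw [htwo] at h
    rw [setLIntegral_one, hlevel, hpow]
    calc σ {x | ENNReal.ofReal t < M x} *
          (2 * ENNReal.ofReal (t / 2) * ENNReal.ofReal (t ^ (p - 1 - 1)))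
        = 2 * (ENNReal.ofReal (t / 2) * σ {x | ENNReal.ofReal t < M x}) *
          ENNReal.ofReal (t ^ (p - 1 - 1)) := by ring
      _ ≤ 2 * (N * ∫⁻ x in {x | ENNReal.ofReal (t / 2) < f x}, f x ∂σ) *
          ENNReal.ofReal (t ^ (p - 1 - 1)) := by gcongr
      _ = _ := by ring
  have hfpow (x : X) : f x * (2 * f x) ^ (p - 1) = 2 ^ (p - 1) * f x ^ p := by
    rw [ENNReal.mul_rpow_of_nonneg _ _ hp1.le, mul_left_comm]
    nth_rewrite 1 [← ENNReal.rpow_one (f x)]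
    rw [← ENNReal.rpow_add_of_nonneg _ _ zero_le_one hp1.le, add_sub_cancel]
  have hlayerM := ofReal_mul_lintegral_setLIntegral_lt_mul_rpow σ hM
    (measurable_const (a := (1 : ℝ≥0∞))) hp0
  have hlayerf := ofReal_mul_lintegral_setLIntegral_lt_mul_rpow σ (hf.const_mul 2) hf hp1
  simp only [one_mul] at hlayerM
  simp_rw [hfpow] at hlayerf
  rw [lintegral_const_mul _ (hf.pow_const p)] at hlayerf
  rw [← hlayerM, mul_assoc, mul_assoc (2 * (N : ℝ≥0∞)), mul_assoc (ENNReal.ofReal (p - 1))⁻¹,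
    ← hlayerf, ENNReal.inv_mul_cancel_left hp1' ENNReal.ofReal_ne_top,
    ← lintegral_const_mul' (2 * (N : ℝ≥0∞)) _ (by finiteness)]
  exact mul_le_mul' le_rfl (setLIntegral_mono' measurableSet_Ioi hweak)

end HardyLittlewood

section WolffPotential

variable {n : ℕ} {s : ℝ}

lemma measurable_wolffS_integrand (σ : Measure (EuclideanSpace ℝ (Fin n))) [SFinite σ] :
    Measurable fun z : EuclideanSpace ℝ (Fin n) × ℝ =>
      (σ (ball z.1 z.2) / ENNReal.ofReal z.2 ^ (n - 1)) ^ (1 / (s - 1)) :=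
  ((measurable_measure_ball σ).div (by fun_prop)).pow_const _

lemma measurable_wolffS (σ : Measure (EuclideanSpace ℝ (Fin n))) [SFinite σ] :
    Measurable (wolffS n s σ) :=
  (measurable_wolffS_integrand σ).lintegral_prod_right'

/-- The Wolff potential of `ν` is controlled by the maximal function of `ν` relative to `σ`. -/
lemma wolffS_le_centeredMaximal_rpow_mul (hs : 1 < s)
    {σ ν : Measure (EuclideanSpace ℝ (Fin n))} [SFinite σ] (hac : ν ≪ σ)
    (hfin : ∀ (x : EuclideanSpace ℝ (Fin n)) (ρ : ℝ), σ (ball x ρ) < ⊤)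
    (x : EuclideanSpace ℝ (Fin n)) :
    wolffS n s ν x ≤ centeredMaximal σ ν x ^ (1 / (s - 1)) * wolffS n s σ x := by
  have hs' : 0 ≤ 1 / (s - 1) := by
    have : 0 < s - 1 := by linarith
    positivity
  unfold wolffS
  have hmeas : Measurable fun t : ℝ =>
      (σ (ball x t) / ENNReal.ofReal t ^ (n - 1)) ^ (1 / (s - 1)) :=
    (((measurable_measure_ball σ).comp measurable_prodMk_left).div (by fun_prop)).pow_const _
  rw [← lintegral_const_mul _ hmeas]
  refine lintegral_mono fun t => ?_
  rw [← ENNReal.mul_rpow_of_nonneg _ _ hs', ← mul_div_assoc]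
  exact ENNReal.rpow_le_rpow
    (ENNReal.div_le_div_right (measure_ball_le_centeredMaximal_mul hac hfin x t) _) hs'

end WolffPotential

/-- Claim: weighted norm inequality for the classical Wolff potential. -/
theorem wolff_weighted_norm_inequality
    (n : ℕ) (hn : 3 ≤ n) (s r α : ℝ) (hs : 1 < s) (hr0 : 0 < r) (hrs : r < s - 1)
    (hα : r - 1 < α)
    (σ : Measure (EuclideanSpace ℝ (Fin n)))
    (hσfin : ∀ (x : EuclideanSpace ℝ (Fin n)) (ρ : ℝ), σ (ball x ρ) < ⊤)
    (hW : (∫⁻ x, (wolffS n s σ x) ^ ((s - 1) * (1 + α) / (s - 1 - r)) ∂σ) < ⊤) :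
    ∃ c₀ : ℝ, 0 < c₀ ∧
      ∀ u : EuclideanSpace ℝ (Fin n) → ℝ≥0∞, Measurable u →
        (∫⁻ x, (wolffS n s (σ.withDensity fun y => (u y) ^ r) x) ^ (1 + α) ∂σ) ≤
          ENNReal.ofReal c₀ * (∫⁻ x, (u x) ^ (1 + α) ∂σ) ^ (r / (s - 1)) := by
  have : IsLocallyFiniteMeasure σ :=
    ⟨fun x => ⟨ball x 1, ball_mem_nhds x one_pos, hσfin x 1⟩⟩
  have hs0 : 0 < s - 1 := by linarith
  have hsr : 0 < s - 1 - r := by linarith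
  have hα0 : 0 < 1 + α := by linarith
  have hp : 1 < (1 + α) / r := by rw [one_lt_div hr0]; linarith
  have hholder : ((s - 1) / r).HolderConjugate ((s - 1) / (s - 1 - r)) := by
    rw [Real.holderConjugate_iff]
    refine ⟨by rwa [one_lt_div hr0], ?_⟩
    field_simp
    ring
  obtain ⟨C, hC, hmax⟩ := exists_lintegral_centeredMaximal_rpow_le σ hσfin hp
  set K : ℝ≥0∞ := C ^ (r / (s - 1)) *
    (∫⁻ x, (wolffS n s σ x) ^ ((s - 1) * (1 + α) / (s - 1 - r)) ∂σ) ^ ((s - 1 - r) / (s - 1))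
    with hKdef
  have hK : K ≠ ⊤ := ENNReal.mul_ne_top
    (ENNReal.rpow_ne_top_of_nonneg (by positivity) hC)
    (ENNReal.rpow_ne_top_of_nonneg (by positivity) hW.ne)
  refine ⟨K.toReal + 1, by positivity, fun u hu => ?_⟩
  have hur : Measurable fun y => u y ^ r := hu.pow_const r
  set ν := σ.withDensity fun y => u y ^ r
  have hpoint (x : EuclideanSpace ℝ (Fin n)) : wolffS n s ν x ^ (1 + α) ≤
      centeredMaximal σ ν x ^ ((1 + α) / (s - 1)) * wolffS n s σ x ^ (1 + α) := by
    refine (ENNReal.rpow_le_rpow (wolffS_le_centeredMaximal_rpow_mul hs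
      (withDensity_absolutelyContinuous σ _) hσfin x) hα0.le).trans_eq ?_
    rw [ENNReal.mul_rpow_of_nonneg _ _ hα0.le, ← ENNReal.rpow_mul, one_div_mul_eq_div]
  have hpow_max : (1 + α) / (s - 1) * ((s - 1) / r) = (1 + α) / r := by field_simp
  have hpow_W : (1 + α) * ((s - 1) / (s - 1 - r)) = (s - 1) * (1 + α) / (s - 1 - r) := by ring
  have hpow_u : r * ((1 + α) / r) = 1 + α := by field_simp
  have hmaxu := hmax _ hur
  simp_rw [← ENNReal.rpow_mul, hpow_u] at hmaxu
  have hH := ENNReal.lintegral_mul_le_Lp_mul_Lq σ hholder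
    (f := fun x => centeredMaximal σ ν x ^ ((1 + α) / (s - 1)))
    (g := fun x => wolffS n s σ x ^ (1 + α))
    ((measurable_centeredMaximal σ ν).pow_const _).aemeasurable
    ((measurable_wolffS σ).pow_const _).aemeasurable
  simp_rw [Pi.mul_apply, ← ENNReal.rpow_mul, hpow_max, hpow_W, one_div_div] at hH
  calc ∫⁻ x, wolffS n s ν x ^ (1 + α) ∂σ
      ≤ _ := lintegral_mono hpoint
    _ ≤ _ := hH
    _ ≤ (C * ∫⁻ x, u x ^ (1 + α) ∂σ) ^ (r / (s - 1)) *
        (∫⁻ x, wolffS n s σ x ^ ((s - 1) * (1 + α) / (s - 1 - r)) ∂σ) ^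
          ((s - 1 - r) / (s - 1)) := by gcongr
    _ = K * (∫⁻ x, u x ^ (1 + α) ∂σ) ^ (r / (s - 1)) := by
        rw [ENNReal.mul_rpow_of_nonneg _ _ (by positivity), hKdef]
        ring
    _ ≤ ENNReal.ofReal (K.toReal + 1) * (∫⁻ x, u x ^ (1 + α) ∂σ) ^ (r / (s - 1)) := by
        gcongr
        rw [ENNReal.le_ofReal_iff_toReal_le hK (by positivity)]
        linarith
end

section
/- Let n ≥ 3, 1 < s < ∞, and r > 0. For every nonnegative Borel measure σ on ℝⁿ finite on bounded sets, every Borel function u : ℝⁿ → [0,∞], and every x ∈ ℝⁿ, one has W_s(u^r·dσ)(x) ≤ ( M_σ(u^r)(x) )^(1/(s−1)) · W_sσ(x), where M_σ v(x) = sup_{t>0} σ(B(x,t))⁻¹ ∫_{B(x,t)} v dσ is the centered maximal operator with respect to σ (all operations in [0,∞], with the convention ∞·0 = 0). -/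
open MeasureTheory Metric Set
open scoped ENNReal

/-- The centered maximal operator with respect to σ. -/
noncomputable def maxOp (n : ℕ) (σ : Measure (EuclideanSpace ℝ (Fin n)))
    (v : EuclideanSpace ℝ (Fin n) → ℝ≥0∞) (x : EuclideanSpace ℝ (Fin n)) : ℝ≥0∞ :=
  ⨆ (t : ℝ) (_ : 0 < t), (σ (ball x t))⁻¹ * ∫⁻ y in ball x t, v y ∂σ

/-- The mass of a ball under `v dσ` is at most the maximal function times its `σ`-mass. -/
theorem withDensity_ball_le_maxOp_mul {n : ℕ} {σ : Measure (EuclideanSpace ℝ (Fin n))}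
    {x : EuclideanSpace ℝ (Fin n)} (v : EuclideanSpace ℝ (Fin n) → ℝ≥0∞) {t : ℝ} (ht : 0 < t)
    (hfin : σ (ball x t) ≠ ⊤) :
    σ.withDensity v (ball x t) ≤ maxOp n σ v x * σ (ball x t) := by
  rw [withDensity_apply _ measurableSet_ball]
  rcases eq_or_ne (σ (ball x t)) 0 with h0 | h0
  · simp [Measure.restrict_eq_zero.mpr h0]
  · calc ∫⁻ y in ball x t, v y ∂σ
        = (σ (ball x t))⁻¹ * (∫⁻ y in ball x t, v y ∂σ) * σ (ball x t) := by
          rw [mul_right_comm, ENNReal.inv_mul_cancel h0 hfin, one_mul]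
      _ ≤ maxOp n σ v x * σ (ball x t) := by
          gcongr
          exact le_iSup₂ (f := fun (t : ℝ) (_ : 0 < t) =>
            (σ (ball x t))⁻¹ * ∫⁻ y in ball x t, v y ∂σ) t ht

/-- Pointwise bound of the Wolff potential of `u^r dσ` by means of the centered
maximal operator. -/
theorem wolff_maximal_pointwise_bound
    (n : ℕ) (hn : 3 ≤ n) (s r : ℝ) (hs : 1 < s) (hr : 0 < r)
    (σ : Measure (EuclideanSpace ℝ (Fin n)))
    (hσfin : ∀ (x : EuclideanSpace ℝ (Fin n)) (ρ : ℝ), σ (ball x ρ) < ⊤)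
    (u : EuclideanSpace ℝ (Fin n) → ℝ≥0∞) (hu : Measurable u)
    (x : EuclideanSpace ℝ (Fin n)) :
    wolffS n s (σ.withDensity fun y => (u y) ^ r) x ≤
      (maxOp n σ (fun y => (u y) ^ r) x) ^ (1 / (s - 1)) * wolffS n s σ x := by
  have he : 0 ≤ 1 / (s - 1) := one_div_nonneg.mpr (sub_nonneg.mpr hs.le)
  have hball : Measurable fun t : ℝ => σ (ball x t) :=
    Monotone.measurable fun _ _ h => measure_mono (ball_subset_ball h)
  have hmeas : Measurable fun t : ℝ =>
      (σ (ball x t) / ENNReal.ofReal t ^ (n - 1)) ^ (1 / (s - 1)) :=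
    (hball.div (ENNReal.measurable_ofReal.pow_const _)).pow_const _
  unfold wolffS
  rw [← lintegral_const_mul _ hmeas]
  refine setLIntegral_mono' measurableSet_Ioi fun t ht => ?_
  rw [← ENNReal.mul_rpow_of_nonneg _ _ he, ← mul_div_assoc]
  gcongr
  exact withDensity_ball_le_maxOp_mul _ ht (hσfin x t).ne
end

section
/- Let n ≥ 3 and let σ be a nonnegative Borel measure on ℝⁿ, finite on bounded sets. If v : ℝⁿ → [0,∞] is Borel and satisfies v(x) ≥ W_G((f∘v)·dσ)(x) for every x ∈ ℝⁿ, then ∫_{ℝⁿ} W_G((f∘v)·dσ)(y) · f(v(y)) dσ(y) ≤ ((q−1)γ+1) · ∫_{ℝⁿ} F(v) dσ. -/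
open MeasureTheory Metric Set
open scoped ENNReal

/-- A power `t * t ^ a` is bounded by any constant `c ≥ a + 1` times the primitive of `t ^ a`. -/
theorem mul_rpow_le_const_mul_rpow_div {a c : ℝ} (ha : 0 ≤ a) (hac : a + 1 ≤ c) (t : ℝ≥0∞) :
    t * t ^ a ≤ ENNReal.ofReal c * (t ^ (a + 1) / ENNReal.ofReal (a + 1)) := by
  have hpos : ENNReal.ofReal (a + 1) ≠ 0 := (ENNReal.ofReal_pos.2 (by linarith)).ne'
  calc t * t ^ a = t ^ (a + 1) := by
        rw [ENNReal.rpow_add_of_nonneg _ _ ha zero_le_one, ENNReal.rpow_one, mul_comm]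
    _ = ENNReal.ofReal (a + 1) * (t ^ (a + 1) / ENNReal.ofReal (a + 1)) :=
        (ENNReal.mul_div_cancel hpos ENNReal.ofReal_ne_top).symm
    _ ≤ _ := by gcongr

theorem mul_ffun_le {p q γ : ℝ} (hp : 1 ≤ p) (hpq : p ≤ q) (hγ : 0 ≤ γ) (t : ℝ≥0∞) :
    t * ffun p q γ t ≤ ENNReal.ofReal ((q - 1) * γ + 1) * Ffun p q γ t := by
  unfold ffun Ffun
  rw [mul_add, mul_add]
  exact add_le_add
    (mul_rpow_le_const_mul_rpow_div (mul_nonneg (by linarith) hγ) (by gcongr) t)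
    (mul_rpow_le_const_mul_rpow_div (mul_nonneg (by linarith) hγ) le_rfl t)

/-- Energy bound for supersolutions of the Wolff integral equation. -/
theorem energy_bound_supersolution
    (n : ℕ) (hn : 3 ≤ n) (p q γ : ℝ) (hp : 1 < p) (hpq : p < q)
    (hγ0 : 0 < γ) (hγ : γ < min ((p - 1) / (q - 1)) (1 / (q - p)))
    (h : ℝ≥0∞ → ℝ≥0∞)
    (hgh : ∀ t, h (gfun p q t) = t) (hhg : ∀ s, gfun p q (h s) = s)
    (σ : Measure (EuclideanSpace ℝ (Fin n)))
    (hσfin : ∀ (x : EuclideanSpace ℝ (Fin n)) (r : ℝ), σ (ball x r) < ⊤)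
    (v : EuclideanSpace ℝ (Fin n) → ℝ≥0∞) (hv : Measurable v)
    (hsuper : ∀ x, wolffG n h (σ.withDensity fun y => ffun p q γ (v y)) x ≤ v x) :
    (∫⁻ y, wolffG n h (σ.withDensity fun z => ffun p q γ (v z)) y * ffun p q γ (v y) ∂σ) ≤
      ENNReal.ofReal ((q - 1) * γ + 1) * ∫⁻ y, Ffun p q γ (v y) ∂σ := by
  rw [← lintegral_const_mul' _ _ ENNReal.ofReal_ne_top]
  refine lintegral_mono fun y => ?_
  exact (mul_le_mul_left (hsuper y) _).trans (mul_ffun_le hp.le hpq.le hγ0.le (v y))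
end

section
/- Let n ≥ 3 and fix γ with 0 < γ < min{(p−1)/(q−1), 1/(q−p)}. There exists ε₀ ∈ (0,1), depending only on n, p, q, γ, with the following property: for every nonnegative Borel measure σ on ℝⁿ, finite on bounded sets, with W_Gσ(x) < ∞ for every x, and every ε ∈ (0, ε₀], the function u₀ := ε·(W_Gσ)^(1/(1−γ)) satisfies W_G((f∘u₀)·dσ)(x) ≥ u₀(x) for every x ∈ ℝⁿ, i.e. u₀ is a subsolution of the integral equation u = W_G((f∘u)·dσ). -/
open MeasureTheory Metric Set
open scoped ENNReal

lemma gfun_monotone {p q : ℝ} (hp : 1 ≤ p) (hq : 1 ≤ q) : Monotone (gfun p q) := fun _ _ hab =>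
  add_le_add (ENNReal.rpow_le_rpow hab (by linarith)) (ENNReal.rpow_le_rpow hab (by linarith))

lemma gfun_mul_le {p q : ℝ} (hp : 1 ≤ p) (hq : 1 ≤ q) (a b : ℝ≥0∞) :
    gfun p q (a * b) ≤ gfun p q a * gfun p q b := by
  unfold gfun
  rw [ENNReal.mul_rpow_of_nonneg _ _ (by linarith), ENNReal.mul_rpow_of_nonneg _ _ (by linarith),
    add_mul, mul_add, mul_add]
  exact add_le_add le_self_add le_add_self

lemma ffun_eq_gfun_rpow (p q γ : ℝ) (t : ℝ≥0∞) : ffun p q γ t = gfun p q (t ^ γ) := by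
  simp only [ffun, gfun, ← ENNReal.rpow_mul, mul_comm γ]

lemma monotone_of_gfun_inverse {p q : ℝ} (hp : 1 ≤ p) (hq : 1 ≤ q) {h : ℝ≥0∞ → ℝ≥0∞}
    (hgh : ∀ t, h (gfun p q t) = t) (hhg : ∀ s, gfun p q (h s) = s) : Monotone h := by
  have hg : StrictMono (gfun p q) :=
    (gfun_monotone hp hq).strictMono_of_injective (Function.LeftInverse.injective hgh)
  intro a b hab
  rw [← hg.le_iff_le, hhg, hhg]
  exact hab

lemma mul_le_of_gfun_inverse {p q : ℝ} (hp : 1 ≤ p) (hq : 1 ≤ q) {h : ℝ≥0∞ → ℝ≥0∞}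
    (hgh : ∀ t, h (gfun p q t) = t) (hhg : ∀ s, gfun p q (h s) = s) (a b : ℝ≥0∞) :
    h a * h b ≤ h (a * b) := by
  have := monotone_of_gfun_inverse hp hq hgh hhg (gfun_mul_le hp hq (h a) (h b))
  rwa [hgh, hhg, hhg] at this

/-- A nonnegative function with finite nonzero integral over `(0, ∞)` splits at some point into two
pieces of equal integral. -/
lemma exists_lintegral_Ioc_eq_half {φ : ℝ → ℝ≥0∞} (hφ : Measurable φ)
    (h0 : ∫⁻ t in Ioi 0, φ t ≠ 0) (hfin : ∫⁻ t in Ioi 0, φ t ≠ ⊤) :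
    ∃ T : ℝ, 0 ≤ T ∧ ∫⁻ t in Ioc 0 T, φ t = (∫⁻ t in Ioi 0, φ t) / 2 ∧
      ∫⁻ t in Ioi T, φ t = (∫⁻ t in Ioi 0, φ t) / 2 := by
  set M := ∫⁻ t in Ioi 0, φ t with hM
  have hint : IntegrableOn (fun t => (φ t).toReal) (Ioi 0) :=
    integrable_toReal_of_lintegral_ne_top hφ.aemeasurable hfin
  have hint' : Integrable ((Ioi (0 : ℝ)).indicator fun t => (φ t).toReal) :=
    hint.integrable_indicator measurableSet_Ioi
  have hreal : ∀ s : Set ℝ, s ⊆ Ioi 0 →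
      ∫ t in s, (φ t).toReal = (∫⁻ t in s, φ t).toReal := by
    intro s hs
    have hs' : ∫⁻ t in s, φ t ≠ ⊤ := ((lintegral_mono_set hs).trans_lt hfin.lt_top).ne
    exact integral_toReal hφ.aemeasurable (ae_lt_top hφ hs')
  have hF : ∀ T, 0 ≤ T → ∫ t in (0 : ℝ)..T, (Ioi (0 : ℝ)).indicator (fun t => (φ t).toReal) t =
      (∫⁻ t in Ioc 0 T, φ t).toReal := by
    intro T hT
    rw [intervalIntegral.integral_of_le hT, ← hreal _ Ioc_subset_Ioi_self]
    exact setIntegral_congr_fun measurableSet_Ioc fun t ht => indicator_of_mem (mem_Ioi.2 ht.1) _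
  have hcont := intervalIntegral.continuous_primitive
    (fun a b => hint'.intervalIntegrable (a := a) (b := b)) 0
  have hlim := intervalIntegral_tendsto_integral_Ioi 0 hint'.integrableOn Filter.tendsto_id
  have htot : ∫ t in Ioi (0 : ℝ), (Ioi (0 : ℝ)).indicator (fun t => (φ t).toReal) t = M.toReal := by
    rw [← hreal _ subset_rfl]
    exact setIntegral_congr_fun measurableSet_Ioi fun t ht => indicator_of_mem ht _
  rw [htot] at hlim
  have hMpos : 0 < M.toReal := ENNReal.toReal_pos h0 hfin
  obtain ⟨S, hS, hS0⟩ := ((hlim.eventually (lt_mem_nhds (half_lt_self hMpos))).and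
    (Filter.eventually_ge_atTop 0)).exists
  obtain ⟨T, hT, hTM⟩ := intermediate_value_Icc hS0 hcont.continuousOn
    (show M.toReal / 2 ∈ _ from ⟨by simp [div_nonneg], hS.le⟩)
  have hIoc : ∫⁻ t in Ioc 0 T, φ t ≠ ⊤ :=
    ((lintegral_mono_set Ioc_subset_Ioi_self).trans_lt hfin.lt_top).ne
  have h1 : ∫⁻ t in Ioc 0 T, φ t = M / 2 := by
    rw [← ENNReal.toReal_eq_toReal_iff' hIoc (ENNReal.div_ne_top hfin two_ne_zero),
      ← hF T hT.1, ENNReal.toReal_div]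
    exact hTM
  refine ⟨T, hT.1, h1, ?_⟩
  have hadd : (∫⁻ t in Ioc 0 T, φ t) + ∫⁻ t in Ioi T, φ t = M := by
    rw [hM, ← Ioc_union_Ioi_eq_Ioi hT.1, lintegral_union measurableSet_Ioi Ioc_disjoint_Ioi_same]
  rw [h1] at hadd
  refine (ENNReal.add_right_inj (ENNReal.div_ne_top hfin two_ne_zero : M / 2 ≠ ⊤)).1 ?_
  rw [hadd, ENNReal.add_halves]

lemma measurable_wolffG_integrand {n : ℕ} {h : ℝ≥0∞ → ℝ≥0∞} (hh : Monotone h)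
    (σ : Measure (EuclideanSpace ℝ (Fin n))) (x : EuclideanSpace ℝ (Fin n)) :
    Measurable fun t : ℝ => h (σ (ball x t) / ENNReal.ofReal t ^ (n - 1)) := by
  have hm : Monotone fun t : ℝ => σ (ball x t) := fun a b hab => measure_mono (ball_subset_ball hab)
  exact hh.measurable.comp (hm.measurable.div (ENNReal.measurable_ofReal.pow_const _))

/-- On the ball `B(x, T)` the potential of `σ` is bounded below by a multiple of the tail at `x`. -/
lemma mul_lintegral_Ioi_le_wolffG {n : ℕ} {h : ℝ≥0∞ → ℝ≥0∞} (hh : Monotone h)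
    (hmul : ∀ a b, h a * h b ≤ h (a * b)) (σ : Measure (EuclideanSpace ℝ (Fin n)))
    {x y : EuclideanSpace ℝ (Fin n)} {T : ℝ} (hT : 0 ≤ T) (hy : dist x y ≤ T) :
    h (2⁻¹ ^ (n - 1)) * ∫⁻ t in Ioi T, h (σ (ball x t) / ENNReal.ofReal t ^ (n - 1)) ≤
      wolffG n h σ y := by
  rw [← lintegral_const_mul _ (measurable_wolffG_integrand hh σ x), wolffG,
    ← lintegral_indicator measurableSet_Ioi, ← lintegral_indicator measurableSet_Ioi,
    ← lintegral_add_right_eq_self ((Ioi (0 : ℝ)).indicator _) T]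
  refine lintegral_mono fun r => ?_
  rcases le_or_gt r T with hr | hr
  · rw [indicator_of_notMem (by simpa using hr)]
    exact zero_le
  rw [indicator_of_mem (mem_Ioi.2 hr),
    indicator_of_mem (show r + T ∈ Ioi (0 : ℝ) by simp only [mem_Ioi]; linarith)]
  refine (hmul _ _).trans (hh ?_)
  have hball : σ (ball x r) ≤ σ (ball y (r + T)) :=
    measure_mono (ball_subset_ball' (by linarith))
  have hrad : ENNReal.ofReal (r + T) ≤ 2 * ENNReal.ofReal r := by
    rw [two_mul, ← ENNReal.ofReal_add (by linarith) (by linarith)]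
    exact ENNReal.ofReal_le_ofReal (by linarith)
  calc 2⁻¹ ^ (n - 1) * (σ (ball x r) / ENNReal.ofReal r ^ (n - 1))
      = σ (ball x r) / (2 * ENNReal.ofReal r) ^ (n - 1) := by
        rw [mul_pow, div_eq_mul_inv, div_eq_mul_inv, ENNReal.mul_inv (by simp) (by simp),
          ENNReal.inv_pow (a := 2)]
        ring
    _ ≤ σ (ball y (r + T)) / ENNReal.ofReal (r + T) ^ (n - 1) := by gcongr

lemma mul_rpow_le_of_le {γ c w ε : ℝ} (hγ1 : γ < 1) (hc : 0 < c) (hw : 0 < w)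
    (hε : 0 < ε)
    (hεc : ε ≤ ((c / 2) ^ (1 / (1 - γ) * γ) / 2) ^ (1 / (1 - γ))) :
    ε * w ^ (1 / (1 - γ)) ≤ (ε * (c * (w / 2)) ^ (1 / (1 - γ))) ^ γ * (w / 2) := by
  have h1 : 0 < 1 - γ := by linarith
  have hβ : 1 / (1 - γ) = 1 / (1 - γ) * γ + 1 := by field_simp; ring
  have hε' : ε ^ (1 - γ) ≤ (c / 2) ^ (1 / (1 - γ) * γ) / 2 := by
    have := Real.rpow_le_rpow hε.le hεc h1.le
    rwa [← Real.rpow_mul (by positivity), one_div_mul_cancel h1.ne', Real.rpow_one] at this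
  have hsplit : ε = ε ^ γ * ε ^ (1 - γ) := by
    rw [← Real.rpow_add hε, add_sub_cancel, Real.rpow_one]
  calc ε * w ^ (1 / (1 - γ))
      = ε ^ γ * ε ^ (1 - γ) * (w ^ (1 / (1 - γ) * γ) * w) := by
        rw [← hsplit, ← Real.rpow_add_one hw.ne', ← hβ]
    _ ≤ ε ^ γ * ((c / 2) ^ (1 / (1 - γ) * γ) / 2) * (w ^ (1 / (1 - γ) * γ) * w) := by gcongr
    _ = (ε * (c * (w / 2)) ^ (1 / (1 - γ))) ^ γ * (w / 2) := by
        rw [show c * (w / 2) = c / 2 * w by ring, Real.mul_rpow hε.le (by positivity),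
          ← Real.rpow_mul (by positivity), Real.mul_rpow (by positivity) hw.le]
        ring

/-- For ε small enough, `u₀ = ε (W_Gσ)^(1/(1−γ))` is a subsolution of the Wolff
integral equation `u = W_G((f∘u)dσ)`. -/
theorem subsolution_small_epsilon
    (n : ℕ) (hn : 3 ≤ n) (p q γ : ℝ) (hp : 1 < p) (hpq : p < q)
    (hγ0 : 0 < γ) (hγ : γ < min ((p - 1) / (q - 1)) (1 / (q - p)))
    (h : ℝ≥0∞ → ℝ≥0∞)
    (hgh : ∀ t, h (gfun p q t) = t) (hhg : ∀ s, gfun p q (h s) = s) :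
    ∃ ε₀ : ℝ, 0 < ε₀ ∧ ε₀ < 1 ∧
      ∀ σ : Measure (EuclideanSpace ℝ (Fin n)),
        (∀ (x : EuclideanSpace ℝ (Fin n)) (r : ℝ), σ (ball x r) < ⊤) →
        (∀ x, wolffG n h σ x < ⊤) →
        ∀ ε : ℝ, 0 < ε → ε ≤ ε₀ →
          ∀ x, ENNReal.ofReal ε * (wolffG n h σ x) ^ (1 / (1 - γ)) ≤
            wolffG n h (σ.withDensity fun y =>
              ffun p q γ (ENNReal.ofReal ε * (wolffG n h σ y) ^ (1 / (1 - γ)))) x := by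
  have hγ1 : γ < 1 := (hγ.trans_le (min_le_left _ _)).trans
    ((div_lt_one (by linarith)).2 (by linarith))
  have hβ : 0 < 1 / (1 - γ) := one_div_pos.2 (by linarith)
  have hh := monotone_of_gfun_inverse hp.le (hp.trans hpq).le hgh hhg
  have hmul := mul_le_of_gfun_inverse hp.le (hp.trans hpq).le hgh hhg
  have hc1 : h (2⁻¹ ^ (n - 1)) ≤ 1 := by
    have h2 : (2⁻¹ : ℝ≥0∞) ^ (n - 1) ≤ gfun p q 1 := by
      refine (pow_le_one₀ zero_le (ENNReal.inv_le_one.2 one_le_two)).trans ?_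
      simp [gfun]
    exact (hh h2).trans_eq (hgh 1)
  have hc0 : h (2⁻¹ ^ (n - 1)) ≠ 0 := by
    intro h0
    have h2 := hhg (2⁻¹ ^ (n - 1))
    rw [h0, gfun, ENNReal.zero_rpow_of_pos (by linarith), ENNReal.zero_rpow_of_pos (by linarith),
      add_zero] at h2
    exact pow_ne_zero _ (by simp) h2.symm
  obtain ⟨c, hc, hcpos, hcle⟩ : ∃ c : ℝ, h (2⁻¹ ^ (n - 1)) = ENNReal.ofReal c ∧ 0 < c ∧ c ≤ 1 := by
    have hctop := (hc1.trans_lt ENNReal.one_lt_top).ne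
    refine ⟨_, (ENNReal.ofReal_toReal hctop).symm, ENNReal.toReal_pos hc0 hctop, ?_⟩
    simpa using ENNReal.toReal_mono ENNReal.one_ne_top hc1
  refine ⟨((c / 2) ^ (1 / (1 - γ) * γ) / 2) ^ (1 / (1 - γ)), by positivity, ?_, ?_⟩
  · refine Real.rpow_lt_one (by positivity) ?_ hβ
    have : (c / 2) ^ (1 / (1 - γ) * γ) ≤ 1 :=
      Real.rpow_le_one (by positivity) (by linarith) (by positivity)
    linarith
  intro σ _ hW ε hε hεc x
  rcases eq_or_ne (wolffG n h σ x) 0 with hW0 | hW0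
  · simp [hW0, ENNReal.zero_rpow_of_pos hβ, -one_div]
  have hφ := measurable_wolffG_integrand hh σ x
  obtain ⟨T, hT, hIoc, hIoi⟩ := exists_lintegral_Ioc_eq_half hφ hW0 (hW x).ne
  change _ = wolffG n h σ x / 2 at hIoc hIoi
  set W := wolffG n h σ x with hWdef
  set A := (ENNReal.ofReal ε * (ENNReal.ofReal c * (W / 2)) ^ (1 / (1 - γ))) ^ γ with hA
  have hAW : ENNReal.ofReal ε * W ^ (1 / (1 - γ)) ≤ A * (W / 2) := by
    have hw : 0 < W.toReal := ENNReal.toReal_pos hW0 (hW x).ne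
    have hWr : W = ENNReal.ofReal W.toReal := (ENNReal.ofReal_toReal (hW x).ne).symm
    have key := ENNReal.ofReal_le_ofReal (mul_rpow_le_of_le hγ1 hcpos hw hε hεc)
    rw [ENNReal.ofReal_mul hε.le, ENNReal.ofReal_mul (by positivity),
      ← ENNReal.ofReal_rpow_of_pos hw, ← ENNReal.ofReal_rpow_of_pos (by positivity),
      ENNReal.ofReal_mul hε.le, ← ENNReal.ofReal_rpow_of_pos (by positivity),
      ENNReal.ofReal_mul hcpos.le, ENNReal.ofReal_div_of_pos two_pos, ← hWr] at key
    simpa only [hA, ENNReal.ofReal_ofNat] using key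
  refine hAW.trans ?_
  rw [← hIoc, ← lintegral_const_mul _ hφ, wolffG]
  refine le_trans ?_ (lintegral_mono_set (Ioc_subset_Ioi_self (a := T)))
  refine setLIntegral_mono' measurableSet_Ioc fun t ht => ?_
  rw [← hgh A]
  refine (hmul _ _).trans (hh ?_)
  rw [← mul_div_assoc]
  gcongr
  rw [withDensity_apply _ measurableSet_ball, ← setLIntegral_const]
  refine setLIntegral_mono' measurableSet_ball fun y hy => ?_
  rw [ffun_eq_gfun_rpow]
  refine gfun_monotone hp.le (hp.trans hpq).le (ENNReal.rpow_le_rpow ?_ hγ0.le)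
  gcongr
  rw [← hc, ← hIoi]
  exact mul_lintegral_Ioi_le_wolffG hh hmul σ hT
    ((mem_ball'.1 hy).le.trans ht.2)
end
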